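/- Let G = (V, E, s) be a graph in which every node is reachable from s. The A-C family AC = { {a} ∪ ⋃_{i=1}^{j} D(S^a_i) : a ∈ V, 0 ≤ j ≤ k_a } is a nesting decomposition of G: its members are pairwise non-overlapping modules of G, and it contains the whole node set V and every singleton {v} for v ∈ V. -/

import Mathlib

open Relation

variable {V : Type*}

/-- `p` is a path from `a` to `b` in the arc relation `E`:
a nonempty list of nodes starting at `a`, ending at `b`,
in which every consecutive pair of nodes is an arc. -/
def IsPath (E : V → V → Prop) (a b : V) (p : List V) : Prop :=
  p ≠ [] ∧ p.head? = some a ∧ p.getLast? = some b ∧ p.Chain' E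

/-- `a` dominates `b` (written `a ≥_s b`): every path from `s` to `b` contains `a`. -/
def Dom (E : V → V → Prop) (s a b : V) : Prop :=
  ∀ p : List V, IsPath E s b p → a ∈ p

/-- `m` is a source of module `M`: `m ∈ M`, every arc entering `M` from outside goes
to `m`, and (convention) if `s ∈ M` then `m = s`. -/
def ModuleSource (E : V → V → Prop) (s : V) (M : Set V) (m : V) : Prop :=
  m ∈ M ∧ (∀ u v, E u v → u ∉ M → v ∈ M → v = m) ∧ (s ∈ M → m = s)

/-- `M` is a module of the graph `(V, E, s)`. -/
def IsModule (E : V → V → Prop) (s : V) (M : Set V) : Prop :=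
  ∃ m, ModuleSource E s M m

/-- Two sets overlap: they intersect but neither contains the other. -/
def Overlap (M H : Set V) : Prop :=
  (M ∩ H).Nonempty ∧ ¬ M ⊆ H ∧ ¬ H ⊆ M

/-- A nesting decomposition: a collection of pairwise non-overlapping modules
containing the trivial modules (the whole node set and all singletons). -/
def IsNestingDecomp (E : V → V → Prop) (s : V) (F : Set (Set V)) : Prop :=
  (∀ M ∈ F, IsModule E s M) ∧
  (∀ M ∈ F, ∀ H ∈ F, ¬ Overlap M H) ∧
  (Set.univ : Set V) ∈ F ∧
  (∀ v : V, ({v} : Set V) ∈ F)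

/-- The maximal module partition of `M` within the family `F`. -/
def MaxPartition (F : Set (Set V)) (M : Set V) : Set (Set V) :=
  {H | H ∈ F ∧ H ⊂ M ∧ ¬ ∃ K ∈ F, H ⊂ K ∧ K ⊂ M}

/-- The width of a nesting decomposition `F`. -/
noncomputable def NDWidth (F : Set (Set V)) : ℕ :=
  ⨆ M ∈ F, (MaxPartition F M).ncard

/-- The nesting width of the graph `(V, E, s)`. -/
noncomputable def nestingWidth (E : V → V → Prop) (s : V) : ℕ :=
  sInf {w : ℕ | ∃ F : Set (Set V), IsNestingDecomp E s F ∧ NDWidth F = w}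

/-- `D(a)`: the set of nodes dominated by `a`. -/
def DomSet (E : V → V → Prop) (s a : V) : Set V := {v | Dom E s a v}

/-- `v` is a child of `a` in the dominator tree. -/
def IsChild (E : V → V → Prop) (s a v : V) : Prop :=
  v ≠ a ∧ Dom E s a v ∧ ∀ b, b ≠ a → b ≠ v → ¬(Dom E s a b ∧ Dom E s b v)

/-- `C(a)`: the set of children of `a` in the dominator tree. -/
def Children (E : V → V → Prop) (s a : V) : Set V := {v | IsChild E s a v}

/-- The arc relation of the graph `G_a` on the children of `a`. -/
def GArc (E : V → V → Prop) (s a : V) (u v : V) : Prop :=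
  u ∈ Children E s a ∧ v ∈ Children E s a ∧ u ≠ v ∧
    ∃ x y, E x y ∧ x ∈ DomSet E s u ∧ y ∈ DomSet E s v

/-- `S` is a strongly connected component of `G_a`
(an equivalence class of mutual reachability in `G_a`). -/
def IsSCC (E : V → V → Prop) (s a : V) (S : Set V) : Prop :=
  ∃ u ∈ Children E s a,
    S = {v | v ∈ Children E s a ∧ ReflTransGen (GArc E s a) u v ∧
          ReflTransGen (GArc E s a) v u}

/-- `L` lists the strongly connected components of `G_a` in topological order:
each member is an SCC of `G_a`, every child of `a` lies in exactly one listed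
component, and every arc of `G_a` goes from an earlier component to the same
or a later component. -/
def IsTopoSCCList (E : V → V → Prop) (s a : V) (L : List (Set V)) : Prop :=
  (∀ S ∈ L, IsSCC E s a S) ∧
  (∀ v ∈ Children E s a, ∃! i : Fin L.length, v ∈ L.get i) ∧
  (∀ i j : Fin L.length, ∀ u ∈ L.get i, ∀ v ∈ L.get j, GArc E s a u v → i ≤ j)

/-- `D(S) = ⋃_{v ∈ S} D(v)`. -/
def DSet (E : V → V → Prop) (s : V) (S : Set V) : Set V := ⋃ v ∈ S, DomSet E s v

/-- The set `{a} ∪ ⋃_{i=1}^{j} D(S^a_i)` (components indexed from 0 in the list). -/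
def PrefixModule (E : V → V → Prop) (s a : V) (L : List (Set V)) (j : ℕ) : Set V :=
  {a} ∪ ⋃ i ∈ Finset.range j, DSet E s (L.getD i ∅)

/-- The A-C family determined by a choice `L` of topologically ordered SCC lists. -/
def ACFamily (E : V → V → Prop) (s : V) (L : V → List (Set V)) : Set (Set V) :=
  {M | ∃ (a : V) (j : ℕ), j ≤ (L a).length ∧ M = PrefixModule E s a (L a) j}

/-- The quantity `max { |S^a_i| : a ∈ V, 1 ≤ i ≤ k_a }`. -/
noncomputable def MaxSCCSize (L : V → List (Set V)) : ℕ :=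
  ⨆ a : V, ⨆ i ∈ Finset.range (L a).length, ((L a).getD i ∅).ncard

section Dominators

variable {E : V → V → Prop} {s : V}

lemma isPath_singleton : IsPath E s s [s] :=
  ⟨by simp, by simp, by simp, List.isChain_singleton s⟩

lemma IsPath.concat {u v : V} {p : List V} (hp : IsPath E s u p) (huv : E u v) :
    IsPath E s v (p ++ [v]) := by
  obtain ⟨hne, hhead, hlast, hchain⟩ := hp
  refine ⟨by simp, ?_, by simp, ?_⟩
  · rw [List.head?_append_of_ne_nil _ hne, hhead]
  · refine List.isChain_append.2 ⟨hchain, by simp, ?_⟩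
    intro x hx y hy
    simp_all

lemma IsPath.mem_last {v : V} {p : List V} (hp : IsPath E s v p) : v ∈ p :=
  List.mem_of_getLast? hp.2.2.1

lemma IsPath.induction {Q : List V → V → Prop} (base : Q [s] s)
    (step : ∀ p u v, E u v → Q p u → Q (p ++ [v]) v)
    {p : List V} {v : V} (hp : IsPath E s v p) : Q p v := by
  induction p using List.reverseRecOn generalizing v with
  | nil => exact absurd rfl hp.1
  | append_singleton q w ih =>
    obtain ⟨-, hhead, hlast, hchain⟩ := hp
    obtain rfl : w = v := by simpa using hlast
    rcases List.eq_nil_or_concat q with rfl | ⟨r, u, rfl⟩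
    · obtain rfl : w = s := by simpa using hhead
      exact base
    · obtain ⟨hq, -, hE⟩ := List.isChain_append.1 hchain
      refine step _ u w (hE u (by simp) w (by simp)) (ih ⟨by simp, ?_, by simp, hq⟩)
      rwa [List.head?_append_of_ne_nil _ (by simp)] at hhead

lemma Dom.refl (a : V) : Dom E s a a := fun _ hp => hp.mem_last

lemma Dom.eq_source {a : V} (h : Dom E s a s) : a = s := by
  simpa using h [s] isPath_singleton

lemma Dom.of_arc {a u v : V} (h : Dom E s a v) (hne : v ≠ a) (huv : E u v) : Dom E s a u := by
  intro p hp
  rcases List.mem_append.1 (h _ (hp.concat huv)) with h | h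
  · exact h
  · exact absurd (List.mem_singleton.1 h).symm hne

/-- Dominance by `a` is the largest predicate that holds at the source only if `a` is the source,
and that propagates backwards along arcs not ending at `a`. -/
lemma Dom.coinduction {a : V} (P : V → Prop) (base : P s → s = a)
    (step : ∀ u v, E u v → P v → v ≠ a → P u) {v : V} (hv : P v) : Dom E s a v := by
  intro p hp
  refine hp.induction (Q := fun p v => P v → a ∈ p) ?_ ?_ hv
  · intro h
    simp [base h]
  · intro p u v huv ih h
    by_cases hva : v = a
    · simp [hva]
    · exact List.mem_append_left _ (ih (step u v huv h hva))

lemma Dom.trans {a b c : V} (hab : Dom E s a b) (hbc : Dom E s b c) : Dom E s a c := by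
  refine Dom.coinduction (fun v => Dom E s a v ∨ Dom E s b v) ?_ ?_ (Or.inr hbc)
  · rintro (h | h)
    · exact h.eq_source.symm
    · obtain rfl := h.eq_source
      exact hab.eq_source.symm
  · rintro u v huv (h | h) hva
    · exact Or.inl (h.of_arc hva huv)
    · by_cases hvb : v = b
      · subst hvb
        exact Or.inl (hab.of_arc hva huv)
      · exact Or.inr (h.of_arc hvb huv)

lemma reach_induction {v : V} (hreach : ∃ p : List V, IsPath E s v p) {Q : V → Prop} (base : Q s)
    (step : ∀ u v, E u v → Q u → Q v) : Q v := by
  obtain ⟨p, hp⟩ := hreach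
  exact hp.induction (Q := fun _ v => Q v) base fun _ => step

lemma Dom.antisymm {a b : V} (hreach : ∃ p : List V, IsPath E s a p)
    (hab : Dom E s a b) (hba : Dom E s b a) : a = b := by
  by_contra hne
  refine reach_induction (Q := fun v => ¬ (Dom E s a v)) hreach ?_ ?_ (Dom.refl a)
  · intro ha
    exact hne (ha.eq_source.trans (hba.trans ha).eq_source.symm)
  · intro u v huv ih ha
    by_cases hva : v = a
    · exact ih (hab.trans ((hba.trans ha).of_arc (hva ▸ hne) huv))
    · exact ih (ha.of_arc hva huv)

lemma Dom.total {a b x : V} (hreach : ∃ p : List V, IsPath E s x p)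
    (ha : Dom E s a x) (hb : Dom E s b x) : Dom E s a b ∨ Dom E s b a := by
  by_contra! h
  refine reach_induction (Q := fun v => ¬ (Dom E s a v ∧ Dom E s b v)) hreach ?_ ?_ ⟨ha, hb⟩
  · rintro ⟨ha, hb⟩
    apply h.1
    rw [ha.eq_source, hb.eq_source]
    exact Dom.refl s
  · rintro u v huv ih ⟨ha, hb⟩
    have hva : v ≠ a := by rintro rfl; exact h.2 hb
    have hvb : v ≠ b := by rintro rfl; exact h.1 ha
    exact ih ⟨ha.of_arc hva huv, hb.of_arc hvb huv⟩

lemma exists_isChild_dom [Finite V] (hreach : ∀ v : V, ∃ p : List V, IsPath E s v p) {a x : V}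
    (hax : Dom E s a x) (hne : x ≠ a) : ∃ w, IsChild E s a w ∧ Dom E s w x := by
  obtain ⟨w, ⟨hwa, haw, hwx⟩, hmax⟩ := Set.Finite.exists_maximalFor (DomSet E s)
    {w | w ≠ a ∧ Dom E s a w ∧ Dom E s w x} (Set.toFinite _) ⟨x, hne, hax, Dom.refl x⟩
  refine ⟨w, ⟨hwa, haw, ?_⟩, hwx⟩
  rintro b hba hbw ⟨hab, hdom⟩
  have hsub : DomSet E s b ⊆ DomSet E s w :=
    hmax ⟨hba, hab, hdom.trans hwx⟩ fun y hy => hdom.trans hy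
  exact hbw (Dom.antisymm (hreach b) hdom (hsub (Dom.refl b)))

lemma IsChild.eq_of_dom {a w w' : V} (hw : IsChild E s a w) (hw' : IsChild E s a w')
    (h : Dom E s w w') : w = w' := by
  by_contra hne
  exact hw'.2.2 w hw.1 hne ⟨hw.2.1, h⟩

lemma IsChild.eq_of_dom_common {a w w' x : V} (hreach : ∃ p : List V, IsPath E s x p)
    (hw : IsChild E s a w) (hw' : IsChild E s a w') (h : Dom E s w x) (h' : Dom E s w' x) :
    w = w' := by
  rcases Dom.total hreach h h' with h | h
  · exact hw.eq_of_dom hw' h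
  · exact (hw'.eq_of_dom hw h).symm

lemma mem_prefixModule {a x : V} {L : List (Set V)} {j : ℕ} :
    x ∈ PrefixModule E s a L j ↔ x = a ∨ ∃ i < j, ∃ w ∈ L.getD i ∅, Dom E s w x := by
  simp [PrefixModule, DSet, DomSet]

lemma IsTopoSCCList.isChild {a w : V} {L : List (Set V)} (hL : IsTopoSCCList E s a L) {i : ℕ}
    (hw : w ∈ L.getD i ∅) : IsChild E s a w := by
  by_cases hi : i < L.length
  · rw [List.getD_eq_getElem _ _ hi] at hw
    obtain ⟨u, -, hS⟩ := hL.1 _ (List.getElem_mem hi)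
    rw [hS] at hw
    exact hw.1
  · rw [List.getD_eq_default _ _ (not_lt.1 hi)] at hw
    exact hw.elim

lemma IsTopoSCCList.exists_mem {a w : V} {L : List (Set V)} (hL : IsTopoSCCList E s a L)
    (hw : IsChild E s a w) : ∃ i < L.length, w ∈ L.getD i ∅ := by
  obtain ⟨i, hi, -⟩ := hL.2.1 w hw
  refine ⟨i, i.2, ?_⟩
  rw [List.getD_eq_getElem _ _ i.2]
  exact hi

lemma IsTopoSCCList.le_of_gArc {a u v : V} {L : List (Set V)} (hL : IsTopoSCCList E s a L)
    {i j : ℕ} (hi : i < L.length) (hj : j < L.length) (hu : u ∈ L.getD i ∅)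
    (hv : v ∈ L.getD j ∅) (h : GArc E s a u v) : i ≤ j := by
  rw [List.getD_eq_getElem _ _ hi] at hu
  rw [List.getD_eq_getElem _ _ hj] at hv
  exact hL.2.2 ⟨i, hi⟩ ⟨j, hj⟩ u hu v hv h

lemma IsTopoSCCList.dom_of_mem_prefixModule {a x : V} {L : List (Set V)}
    (hL : IsTopoSCCList E s a L) {j : ℕ} (hx : x ∈ PrefixModule E s a L j) : Dom E s a x := by
  rcases mem_prefixModule.1 hx with rfl | ⟨i, -, w, hw, hwx⟩
  · exact Dom.refl x
  · exact (hL.isChild hw).2.1.trans hwx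

lemma prefixModule_mono {a : V} {L : List (Set V)} {i j : ℕ} (hij : i ≤ j) :
    PrefixModule E s a L i ⊆ PrefixModule E s a L j := by
  intro x hx
  rw [mem_prefixModule] at hx ⊢
  exact hx.imp_right fun ⟨k, hk, h⟩ => ⟨k, hk.trans_le hij, h⟩

lemma IsTopoSCCList.moduleSource_prefixModule [Finite V]
    (hreach : ∀ v : V, ∃ p : List V, IsPath E s v p) {a : V} {L : List (Set V)}
    (hL : IsTopoSCCList E s a L) {j : ℕ} (hj : j ≤ L.length) :
    ModuleSource E s (PrefixModule E s a L j) a := by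
  refine ⟨mem_prefixModule.2 (Or.inl rfl), ?_, fun h => (hL.dom_of_mem_prefixModule h).eq_source⟩
  intro u v huv hu hv
  by_contra hva
  have hau : Dom E s a u := (hL.dom_of_mem_prefixModule hv).of_arc hva huv
  obtain ⟨i, hi, w, hw, hwv⟩ := (mem_prefixModule.1 hv).resolve_left hva
  apply hu
  by_cases hua : u = a
  · exact mem_prefixModule.2 (Or.inl hua)
  obtain ⟨w', hw', hwu⟩ := exists_isChild_dom hreach hau hua
  by_cases hww : w' = w
  · exact mem_prefixModule.2 (Or.inr ⟨i, hi, w, hw, hww ▸ hwu⟩)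
  obtain ⟨k, hk, hwk⟩ := hL.exists_mem hw'
  have hki : k ≤ i := hL.le_of_gArc hk (hi.trans_le hj) hwk hw
    ⟨hw', hL.isChild hw, hww, u, v, huv, hwu, hwv⟩
  exact mem_prefixModule.2 (Or.inr ⟨k, hki.trans_lt hi, w', hwk, hwu⟩)

lemma prefixModule_subset_of_dom [Finite V] (hreach : ∀ v : V, ∃ p : List V, IsPath E s v p)
    {a b : V} {La Lb : List (Set V)} (hLa : IsTopoSCCList E s a La)
    (hLb : IsTopoSCCList E s b Lb) {i j : ℕ} (hne : a ≠ b) (hab : Dom E s a b)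
    (hmeet : (PrefixModule E s a La i ∩ PrefixModule E s b Lb j).Nonempty) :
    PrefixModule E s b Lb j ⊆ PrefixModule E s a La i := by
  obtain ⟨x, hxa, hxb⟩ := hmeet
  obtain ⟨w, hw, hwb⟩ := exists_isChild_dom hreach hab hne.symm
  have hbx : Dom E s b x := hLb.dom_of_mem_prefixModule hxb
  rcases mem_prefixModule.1 hxa with rfl | ⟨k, hk, w', hw', hwx⟩
  · exact absurd (Dom.antisymm (hreach _) hab hbx) hne
  obtain rfl : w = w' :=
    hw.eq_of_dom_common (hreach x) (hLa.isChild hw') (hwb.trans hbx) hwx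
  intro y hy
  exact mem_prefixModule.2
    (Or.inr ⟨k, hk, w, hw', hwb.trans (hLb.dom_of_mem_prefixModule hy)⟩)

lemma IsTopoSCCList.prefixModule_length_eq_domSet [Finite V]
    (hreach : ∀ v : V, ∃ p : List V, IsPath E s v p) {a : V} {L : List (Set V)}
    (hL : IsTopoSCCList E s a L) : PrefixModule E s a L L.length = DomSet E s a := by
  refine Set.Subset.antisymm (fun x hx => hL.dom_of_mem_prefixModule hx) fun x hx => ?_
  rw [mem_prefixModule]
  by_cases hxa : x = a
  · exact Or.inl hxa
  obtain ⟨w, hw, hwx⟩ := exists_isChild_dom hreach hx hxa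
  obtain ⟨i, hi, hwi⟩ := hL.exists_mem hw
  exact Or.inr ⟨i, hi, w, hwi, hwx⟩

lemma domSet_source : DomSet E s s = Set.univ := by
  refine Set.eq_univ_of_forall fun v p hp => ?_
  exact List.mem_of_head? hp.2.1

end Dominators

/-- the A-C family is a nesting decomposition of `G`: its members
are pairwise non-overlapping modules, and it contains the whole node set and
every singleton. -/
theorem ACFamily_is_nestingDecomp [Fintype V] (E : V → V → Prop) (s : V)
    (hreach : ∀ v : V, ∃ p : List V, IsPath E s v p)
    (L : V → List (Set V)) (hL : ∀ a : V, IsTopoSCCList E s a (L a)) :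
    IsNestingDecomp E s (ACFamily E s L) := by
  refine ⟨?_, ?_, ⟨s, _, le_rfl, ?_⟩, fun v => ⟨v, 0, Nat.zero_le _, by simp [PrefixModule]⟩⟩
  · rintro M ⟨a, j, hj, rfl⟩
    exact ⟨a, (hL a).moduleSource_prefixModule hreach hj⟩
  · rintro M ⟨a, i, -, rfl⟩ H ⟨b, j, -, rfl⟩ ⟨hmeet, hMH, hHM⟩
    by_cases hne : a = b
    · subst hne
      rcases le_total i j with h | h
      · exact hMH (prefixModule_mono h)
      · exact hHM (prefixModule_mono h)
    obtain ⟨x, hxa, hxb⟩ := id hmeet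
    rcases Dom.total (hreach x) ((hL a).dom_of_mem_prefixModule hxa)
      ((hL b).dom_of_mem_prefixModule hxb) with h | h
    · exact hHM (prefixModule_subset_of_dom hreach (hL a) (hL b) hne h hmeet)
    · exact hMH (prefixModule_subset_of_dom hreach (hL b) (hL a) (Ne.symm hne) h
        (Set.inter_comm _ _ ▸ hmeet))
  · rw [(hL s).prefixModule_length_eq_domSet hreach, domSet_source]
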